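/- Let p > 1 and -1 < α < p-1. The Hilbert operator H(a)(m) = ∑_{n=1}^∞ a_n/(m+n) is bounded from l^p_α to l^p_α with operator norm exactly π csc(π(1+α)/p). -/

import Mathlib

open Real

open MeasureTheory Set Filter Topology
open scoped ENNReal

theorem lintegral_rpow_mul_exp_neg_mul_Ioi {a r : ℝ} (ha : 0 < a) (hr : 0 < r) :
    ∫⁻ t in Ioi (0 : ℝ), ENNReal.ofReal (t ^ (a - 1) * exp (-(r * t))) =
      ENNReal.ofReal ((1 / r) ^ a * Gamma a) := by
  rw [← integral_rpow_mul_exp_neg_mul_Ioi ha hr]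
  refine (ofReal_integral_eq_lintegral_ofReal (.of_integral_ne_zero ?_) ?_).symm
  · rw [integral_rpow_mul_exp_neg_mul_Ioi ha hr]
    have := Gamma_pos_of_pos ha
    positivity
  · filter_upwards [ae_restrict_mem measurableSet_Ioi] with t ht
    have : 0 < t := ht
    simp only [Pi.zero_apply]
    positivity

theorem lintegral_rpow_div_add {s c : ℝ} (hs0 : 0 < s) (hs1 : s < 1) (hc : 0 < c) :
    ∫⁻ x in Ioi (0 : ℝ), ENNReal.ofReal (x ^ (-s) / (c + x)) =
      ENNReal.ofReal (π / sin (π * s) * c ^ (-s)) := by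
  have hG : 0 < Gamma (1 - s) := Gamma_pos_of_pos (by linarith)
  calc ∫⁻ x in Ioi (0 : ℝ), ENNReal.ofReal (x ^ (-s) / (c + x))
      = ∫⁻ x in Ioi (0 : ℝ), ∫⁻ t in Ioi (0 : ℝ),
          ENNReal.ofReal (x ^ (-s) * exp (-((c + x) * t))) := by
        refine setLIntegral_congr_fun measurableSet_Ioi fun x hx => ?_
        have hx : 0 < x := hx
        have := lintegral_rpow_mul_exp_neg_mul_Ioi one_pos (add_pos hc hx)
        simp only [sub_self, rpow_zero, one_mul, rpow_one, Gamma_one, mul_one] at this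
        simp only [div_eq_mul_one_div (x ^ (-s))]
        simp_rw [ENNReal.ofReal_mul (rpow_nonneg hx.le (-s))]
        rw [lintegral_const_mul _ (by fun_prop), this]
    _ = ∫⁻ t in Ioi (0 : ℝ), ∫⁻ x in Ioi (0 : ℝ),
          ENNReal.ofReal (x ^ (-s) * exp (-((c + x) * t))) := by
        apply lintegral_lintegral_swap
        apply Measurable.aemeasurable
        unfold Function.uncurry
        fun_prop
    _ = ∫⁻ t in Ioi (0 : ℝ),
          ENNReal.ofReal (Gamma (1 - s)) * ENNReal.ofReal (t ^ (s - 1) * exp (-(c * t))) := by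
        refine setLIntegral_congr_fun measurableSet_Ioi fun t ht => ?_
        have ht : 0 < t := ht
        have key := lintegral_rpow_mul_exp_neg_mul_Ioi (a := 1 - s) (by linarith) ht
        have h (x : ℝ) : x ^ (-s) * exp (-((c + x) * t)) =
            exp (-(c * t)) * (x ^ (1 - s - 1) * exp (-(t * x))) := by
          rw [mul_left_comm, ← exp_add]
          ring_nf
        simp_rw [h, ENNReal.ofReal_mul (exp_pos _).le]
        rw [lintegral_const_mul _ (by fun_prop), key, ← ENNReal.ofReal_mul (exp_pos _).le,
          ← ENNReal.ofReal_mul hG.le, one_div, inv_rpow ht.le, ← rpow_neg ht.le]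
        ring_nf
    _ = ENNReal.ofReal (π / sin (π * s) * c ^ (-s)) := by
        rw [lintegral_const_mul _ (by fun_prop), lintegral_rpow_mul_exp_neg_mul_Ioi hs0 hc,
          ← ENNReal.ofReal_mul hG.le, ← Gamma_mul_Gamma_one_sub, one_div, inv_rpow hc.le,
          ← rpow_neg hc.le]
        ring_nf

theorem antitoneOn_rpow_neg_div_add {s c : ℝ} (hs : 0 ≤ s) (hc : 0 < c) :
    AntitoneOn (fun x : ℝ => x ^ (-s) / (c + x)) (Ioi 0) := by
  intro x hx y hy hxy
  have hx : 0 < x := hx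
  have hy : 0 < y := hy
  exact div_le_div₀ (rpow_nonneg hx.le _) (rpow_le_rpow_of_nonpos hx hxy (by linarith))
    (by positivity) (by linarith)

theorem tsum_rpow_div_add_le {s c : ℝ} (hs0 : 0 < s) (hs1 : s < 1) (hc : 0 < c) :
    ∑' n : ℕ, ENNReal.ofReal (((n : ℝ) + 1) ^ (-s) / (c + (n + 1))) ≤
      ENNReal.ofReal (π / sin (π * s) * c ^ (-s)) := by
  rw [← lintegral_rpow_div_add hs0 hs1 hc]
  have hmono : Monotone fun n : ℕ => (n : ℝ) := Nat.mono_cast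
  calc ∑' n : ℕ, ENNReal.ofReal (((n : ℝ) + 1) ^ (-s) / (c + (n + 1)))
      ≤ ∑' n : ℕ, ∫⁻ x in Ioc (n : ℝ) ((n + 1 : ℕ) : ℝ),
          ENNReal.ofReal (x ^ (-s) / (c + x)) := by
        refine ENNReal.tsum_le_tsum fun n => ?_
        calc ENNReal.ofReal (((n : ℝ) + 1) ^ (-s) / (c + (n + 1)))
            = ∫⁻ _ in Ioc (n : ℝ) ((n + 1 : ℕ) : ℝ),
                ENNReal.ofReal (((n : ℝ) + 1) ^ (-s) / (c + (n + 1))) := by simp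
          _ ≤ _ := by
            refine setLIntegral_mono' measurableSet_Ioc fun x hx => ENNReal.ofReal_le_ofReal ?_
            have hx0 : 0 < x := lt_of_le_of_lt n.cast_nonneg hx.1
            have hx1 : x ≤ n + 1 := by simpa using hx.2
            exact antitoneOn_rpow_neg_div_add hs0.le hc hx0 (hx0.trans_le hx1) hx1
    _ = ∫⁻ x in ⋃ n : ℕ, Ioc (n : ℝ) ((n + 1 : ℕ) : ℝ), ENNReal.ofReal (x ^ (-s) / (c + x)) :=
        (lintegral_iUnion (fun _ => measurableSet_Ioc) hmono.pairwise_disjoint_on_Ioc_succ _).symm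
    _ ≤ _ := by
        refine lintegral_mono_set (iUnion_subset fun n x hx => ?_)
        exact lt_of_le_of_lt n.cast_nonneg hx.1

theorem schur_test {ι κ : Type*} {p q : ℝ} (hpq : p.HolderConjugate q) {K : ι → κ → ℝ≥0∞}
    {g : ι → ℝ≥0∞} {h : κ → ℝ≥0∞} (h0 : ∀ n, h n ≠ 0) (htop : ∀ n, h n ≠ ∞) {B : ℝ≥0∞}
    (hrow : ∀ m, ∑' n, K m n * h n ^ q ≤ B * g m ^ q)
    (hcol : ∀ n, ∑' m, K m n * g m ^ p ≤ B * h n ^ p) (x : κ → ℝ≥0∞) :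
    ∑' m, (∑' n, K m n * x n) ^ p ≤ B ^ p * ∑' n, x n ^ p := by
  have hp := hpq.pos
  have hq := hpq.symm.pos
  have holder (m : ι) : (∑' n, K m n * x n) ^ p ≤
      B ^ (p / q) * ∑' n, (x n ^ p * (h n)⁻¹ ^ p) * (K m n * g m ^ p) := by
    let _ : MeasurableSpace κ := ⊤
    have H := ENNReal.lintegral_mul_le_Lp_mul_Lq (Measure.count : Measure κ) hpq
      (f := fun n => K m n ^ (1 / p) * (x n * (h n)⁻¹)) (g := fun n => K m n ^ (1 / q) * h n)
      (measurable_from_top.aemeasurable) (measurable_from_top.aemeasurable)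
    simp only [lintegral_count, Pi.mul_apply] at H
    have e1 (n : κ) : K m n ^ (1 / p) * (x n * (h n)⁻¹) * (K m n ^ (1 / q) * h n) =
        K m n * x n := by
      calc _ = (K m n ^ (1 / p) * K m n ^ (1 / q)) * x n * ((h n)⁻¹ * h n) := by ring
        _ = _ := by
          rw [ENNReal.inv_mul_cancel (h0 n) (htop n), ← ENNReal.rpow_add_of_nonneg _ _
            (by positivity) (by positivity), one_div, one_div, hpq.inv_add_inv_eq_one,
            ENNReal.rpow_one, mul_one]
    have e2 (n : κ) : (K m n ^ (1 / p) * (x n * (h n)⁻¹)) ^ p =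
        K m n * (x n ^ p * (h n)⁻¹ ^ p) := by
      rw [ENNReal.mul_rpow_of_nonneg _ _ hp.le, ENNReal.mul_rpow_of_nonneg _ _ hp.le,
        ← ENNReal.rpow_mul, one_div_mul_cancel hp.ne', ENNReal.rpow_one]
    have e3 (n : κ) : (K m n ^ (1 / q) * h n) ^ q = K m n * h n ^ q := by
      rw [ENNReal.mul_rpow_of_nonneg _ _ hq.le, ← ENNReal.rpow_mul, one_div_mul_cancel hq.ne',
        ENNReal.rpow_one]
    simp only [e1, e2, e3] at H
    calc (∑' n, K m n * x n) ^ p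
        ≤ ((∑' n, K m n * (x n ^ p * (h n)⁻¹ ^ p)) ^ (1 / p) * (B * g m ^ q) ^ (1 / q)) ^ p := by
          gcongr
          exact H.trans (by gcongr; exact hrow m)
      _ = B ^ (p / q) * ((∑' n, K m n * (x n ^ p * (h n)⁻¹ ^ p)) * g m ^ p) := by
          rw [ENNReal.mul_rpow_of_nonneg _ _ hp.le, ← ENNReal.rpow_mul, one_div_mul_cancel hp.ne',
            ENNReal.rpow_one, ← ENNReal.rpow_mul, ENNReal.mul_rpow_of_nonneg _ _ (by positivity),
            ← ENNReal.rpow_mul, one_div_mul_eq_div, mul_div_cancel₀ _ hq.ne']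
          ring
      _ = _ := by
          rw [← ENNReal.tsum_mul_right]
          congr 2 with n
          ring
  calc ∑' m, (∑' n, K m n * x n) ^ p
      ≤ ∑' m, B ^ (p / q) * ∑' n, (x n ^ p * (h n)⁻¹ ^ p) * (K m n * g m ^ p) :=
        ENNReal.tsum_le_tsum holder
    _ = B ^ (p / q) * ∑' n, (x n ^ p * (h n)⁻¹ ^ p) * ∑' m, K m n * g m ^ p := by
        rw [ENNReal.tsum_mul_left, ENNReal.tsum_comm]
        simp_rw [ENNReal.tsum_mul_left]
    _ ≤ B ^ (p / q) * ∑' n, (x n ^ p * (h n)⁻¹ ^ p) * (B * h n ^ p) := by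
        gcongr with n
        exact hcol n
    _ = B ^ p * ∑' n, x n ^ p := by
        have e (n : κ) : (x n ^ p * (h n)⁻¹ ^ p) * (B * h n ^ p) = B * x n ^ p := by
          calc _ = B * x n ^ p * ((h n)⁻¹ ^ p * h n ^ p) := by ring
            _ = _ := by
              rw [← ENNReal.mul_rpow_of_nonneg _ _ hp.le,
                ENNReal.inv_mul_cancel (h0 n) (htop n), ENNReal.one_rpow, mul_one]
        have hpq' : p / q + 1 = p := by
          have := hpq.sub_one_mul_conj
          field_simp
          linarith
        simp_rw [e]
        rw [ENNReal.tsum_mul_left, ← mul_assoc]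
        nth_rewrite 2 [← ENNReal.rpow_one B]
        rw [← ENNReal.rpow_add_of_nonneg _ _ (by positivity) zero_le_one, hpq']

theorem hilbert_tsum_le {p α : ℝ} (hp : 1 < p) (hα : -1 < α) (hα' : α < p - 1) (a : ℕ → ℝ) :
    ∑' m : ℕ, ENNReal.ofReal (((m : ℝ) + 1) ^ α *
        |∑' n : ℕ, a n / ((m : ℝ) + (n : ℝ) + 2)| ^ p) ≤
      ENNReal.ofReal (π / sin (π * ((1 + α) / p))) ^ p *
        ∑' n : ℕ, ENNReal.ofReal (((n : ℝ) + 1) ^ α * |a n| ^ p) := by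
  have hp0 : 0 < p := by linarith
  have hpq : p.HolderConjugate (p / (p - 1)) := Real.HolderConjugate.conjExponent hp
  set q := p / (p - 1) with hq
  have hq0 : 0 < q := hpq.symm.pos
  set s := (1 + α) / p with hs
  have hs0 : 0 < s := div_pos (by linarith) hp0
  have hs1 : s < 1 := (div_lt_one hp0).2 (by linarith)
  have hsin : sin (π * (1 - s)) = sin (π * s) := by rw [mul_sub, mul_one, sin_pi_sub]
  have hB : 0 ≤ π / sin (π * s) := by
    refine div_nonneg pi_pos.le (sin_nonneg_of_nonneg_of_le_pi (by positivity) ?_)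
    nlinarith [pi_pos]
  have hqp : -(1 / (p * q)) * q = -(1 / p) := by field_simp
  have hpp : -(1 / (p * q)) * p = 1 / p - 1 := by
    rw [hq]
    have : p - 1 ≠ 0 := by linarith
    field_simp
    ring
  have test (r : ℝ) (n : ℕ) : ENNReal.ofReal (((n : ℝ) + 1) ^ (-(1 / (p * q)))) ^ r =
      ENNReal.ofReal (((n : ℝ) + 1) ^ (-(1 / (p * q)) * r)) := by
    rw [ENNReal.ofReal_rpow_of_pos (by positivity), ← rpow_mul (by positivity)]
  have main := schur_test hpq
    (K := fun m n : ℕ => ENNReal.ofReal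
      (((m : ℝ) + 1) ^ (α / p) * ((n : ℝ) + 1) ^ (-(α / p)) / ((m : ℝ) + n + 2)))
    (g := fun n : ℕ => ENNReal.ofReal (((n : ℝ) + 1) ^ (-(1 / (p * q)))))
    (h := fun n : ℕ => ENNReal.ofReal (((n : ℝ) + 1) ^ (-(1 / (p * q)))))
    (fun n => by positivity) (fun n => ENNReal.ofReal_ne_top)
    (B := ENNReal.ofReal (π / sin (π * s)))
    (fun m => by
      simp only [test, hqp]
      calc _ = ENNReal.ofReal (((m : ℝ) + 1) ^ (α / p)) *
            ∑' n : ℕ, ENNReal.ofReal (((n : ℝ) + 1) ^ (-s) / (((m : ℝ) + 1) + (n + 1))) := by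
            rw [← ENNReal.tsum_mul_left]
            congr 1 with n
            rw [← ENNReal.ofReal_mul (by positivity), ← ENNReal.ofReal_mul (by positivity),
              show -s = -(α / p) + -(1 / p) by rw [hs]; ring, rpow_add (by positivity)]
            congr 1
            field_simp
            ring
        _ ≤ ENNReal.ofReal (((m : ℝ) + 1) ^ (α / p)) *
            ENNReal.ofReal (π / sin (π * s) * ((m : ℝ) + 1) ^ (-s)) := by
            gcongr
            exact tsum_rpow_div_add_le hs0 hs1 (by positivity)
        _ = _ := by
            rw [← ENNReal.ofReal_mul (by positivity), ← ENNReal.ofReal_mul hB,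
              show -(1 / p) = α / p + -s by rw [hs]; ring, rpow_add (by positivity)]
            congr 1
            ring)
    (fun n => by
      simp only [test, hpp]
      calc _ = ENNReal.ofReal (((n : ℝ) + 1) ^ (-(α / p))) *
            ∑' m : ℕ, ENNReal.ofReal (((m : ℝ) + 1) ^ (-(1 - s)) / (((n : ℝ) + 1) + (m + 1))) := by
            rw [← ENNReal.tsum_mul_left]
            congr 1 with m
            rw [← ENNReal.ofReal_mul (by positivity), ← ENNReal.ofReal_mul (by positivity),
              show -(1 - s) = α / p + (1 / p - 1) by rw [hs]; ring, rpow_add (by positivity)]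
            congr 1
            field_simp
            ring
        _ ≤ ENNReal.ofReal (((n : ℝ) + 1) ^ (-(α / p))) *
            ENNReal.ofReal (π / sin (π * s) * ((n : ℝ) + 1) ^ (-(1 - s))) := by
            gcongr
            rw [← hsin]
            exact tsum_rpow_div_add_le (by linarith) (by linarith) (by positivity)
        _ = _ := by
            rw [← ENNReal.ofReal_mul (by positivity), ← ENNReal.ofReal_mul hB,
              show 1 / p - 1 = -(α / p) + -(1 - s) by rw [hs]; ring, rpow_add (by positivity)]
            congr 1
            ring)
    (fun n => ENNReal.ofReal (((n : ℝ) + 1) ^ (α / p) * |a n|))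
  have weight (n : ℕ) (y : ℝ) : ENNReal.ofReal (((n : ℝ) + 1) ^ α * |y| ^ p) =
      ENNReal.ofReal (((n : ℝ) + 1) ^ (α / p) * |y|) ^ p := by
    rw [ENNReal.ofReal_rpow_of_nonneg (by positivity) hp0.le,
      mul_rpow (by positivity) (abs_nonneg _), ← rpow_mul (by positivity),
      div_mul_cancel₀ _ hp0.ne']
  simp only [weight]
  refine le_trans (ENNReal.tsum_le_tsum fun m => ?_) main
  gcongr
  rw [ENNReal.ofReal_mul (by positivity), ← Real.enorm_eq_ofReal_abs]
  calc _ ≤ ENNReal.ofReal (((m : ℝ) + 1) ^ (α / p)) *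
        ∑' n : ℕ, ‖a n / ((m : ℝ) + (n : ℝ) + 2)‖ₑ := by
        gcongr
        exact enorm_tsum_le_tsum_enorm
    _ = _ := by
        rw [← ENNReal.tsum_mul_left]
        congr 1 with n
        rw [Real.enorm_eq_ofReal_abs, ← ENNReal.ofReal_mul (by positivity),
          ← ENNReal.ofReal_mul (by positivity), abs_div,
          abs_of_pos (show (0 : ℝ) < (m : ℝ) + n + 2 by positivity), rpow_neg (by positivity)]
        congr 1
        have : ((n : ℝ) + 1) ^ (α / p) ≠ 0 := by positivity
        field_simp

theorem summable_hilbert_and_tsum_le {p α : ℝ} (hp : 1 < p) (hα : -1 < α) (hα' : α < p - 1)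
    {a : ℕ → ℝ} (ha : Summable fun n : ℕ => ((n : ℝ) + 1) ^ α * |a n| ^ p) :
    (Summable fun m : ℕ => ((m : ℝ) + 1) ^ α *
        |∑' n : ℕ, a n / ((m : ℝ) + (n : ℝ) + 2)| ^ p) ∧
      ∑' m : ℕ, ((m : ℝ) + 1) ^ α * |∑' n : ℕ, a n / ((m : ℝ) + (n : ℝ) + 2)| ^ p ≤
        (π / sin (π * ((1 + α) / p))) ^ p * ∑' n : ℕ, ((n : ℝ) + 1) ^ α * |a n| ^ p := by
  have hp0 : 0 < p := by linarith
  have hsin : 0 ≤ sin (π * ((1 + α) / p)) := by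
    refine sin_nonneg_of_nonneg_of_le_pi
      (mul_nonneg pi_pos.le (div_nonneg (by linarith) hp0.le)) ?_
    have : (1 + α) / p ≤ 1 := (div_le_one hp0).2 (by linarith)
    nlinarith [pi_pos]
  have hB : 0 ≤ π / sin (π * ((1 + α) / p)) := by positivity
  have hnn (b : ℕ → ℝ) (n : ℕ) : 0 ≤ ((n : ℝ) + 1) ^ α * |b n| ^ p := by positivity
  have key := hilbert_tsum_le hp hα hα' a
  rw [← ENNReal.ofReal_tsum_of_nonneg (hnn a) ha, ENNReal.ofReal_rpow_of_nonneg hB hp0.le,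
    ← ENNReal.ofReal_mul (by positivity)] at key
  have hsum : Summable fun m : ℕ => ((m : ℝ) + 1) ^ α *
      |∑' n : ℕ, a n / ((m : ℝ) + (n : ℝ) + 2)| ^ p := by
    refine (ENNReal.summable_toReal (key.trans_lt ENNReal.ofReal_lt_top).ne).congr fun m => ?_
    exact ENNReal.toReal_ofReal (by positivity)
  refine ⟨hsum, ?_⟩
  rw [← ENNReal.ofReal_tsum_of_nonneg (fun m => by positivity) hsum] at key
  exact (ENNReal.ofReal_le_ofReal_iff (mul_nonneg (by positivity) (tsum_nonneg (hnn a)))).1 key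

theorem exists_nat_lt_integral_rpow_div {s C : ℝ} (hs0 : 0 < s) (hs1 : s < 1)
    (hC : C < π / sin (π * s)) :
    ∃ K : ℕ, 0 < K ∧ C < ∫ x in (1 / (K : ℝ))..K, x ^ (-s) / (1 + x) := by
  have hnn : 0 ≤ᵐ[volume.restrict (Ioi (0 : ℝ))] fun x : ℝ => x ^ (-s) / (1 + x) := by
    filter_upwards [ae_restrict_mem measurableSet_Ioi] with x hx
    have : 0 < x := hx
    simp only [Pi.zero_apply]
    positivity
  have hB : 0 ≤ π / sin (π * s) := by
    refine div_nonneg pi_pos.le (sin_nonneg_of_nonneg_of_le_pi (by positivity) ?_)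
    nlinarith [pi_pos]
  have hmeas : Measurable fun x : ℝ => x ^ (-s) / (1 + x) := by fun_prop
  have hl := lintegral_rpow_div_add hs0 hs1 one_pos
  rw [one_rpow, mul_one] at hl
  have hint : IntegrableOn (fun x : ℝ => x ^ (-s) / (1 + x)) (Ioi 0) :=
    (lintegral_ofReal_ne_top_iff_integrable hmeas.aestronglyMeasurable hnn).1 (hl ▸ ENNReal.ofReal_ne_top)
  have hval : ∫ x in Ioi (0 : ℝ), x ^ (-s) / (1 + x) = π / sin (π * s) := by
    rw [integral_eq_lintegral_of_nonneg_ae hnn hmeas.aestronglyMeasurable, hl, ENNReal.toReal_ofReal hB]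
  have hU : ⋃ k : ℕ, Ioc (1 / ((k : ℝ) + 1)) ((k : ℝ) + 1) = Ioi 0 := by
    ext x
    simp only [mem_iUnion, mem_Ioc, mem_Ioi]
    constructor
    · rintro ⟨k, hk, -⟩
      exact lt_trans (by positivity) hk
    · intro hx
      obtain ⟨k, hk⟩ := exists_nat_one_div_lt hx
      obtain ⟨l, hl⟩ := exists_nat_ge x
      refine ⟨max k l, lt_of_le_of_lt ?_ hk, hl.trans ?_⟩
      · gcongr
        exact le_max_left k l
      · have : (l : ℝ) ≤ (max k l : ℕ) := by exact_mod_cast le_max_right k l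
        linarith
  have hmono : Monotone fun k : ℕ => Ioc (1 / ((k : ℝ) + 1)) ((k : ℝ) + 1) := by
    intro k l hkl
    refine Ioc_subset_Ioc ?_ ?_ <;> gcongr
  have lim := tendsto_setIntegral_of_monotone (μ := volume)
    (f := fun x : ℝ => x ^ (-s) / (1 + x)) (fun _ => measurableSet_Ioc) hmono (by rwa [hU])
  rw [hU, hval] at lim
  obtain ⟨k, hk⟩ := (lim.eventually (lt_mem_nhds hC)).exists
  refine ⟨k + 1, k.succ_pos, ?_⟩
  push_cast
  rwa [intervalIntegral.integral_of_le]
  rw [div_le_iff₀ (by positivity)]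
  nlinarith [(k.cast_nonneg : (0 : ℝ) ≤ k)]

theorem rpow_mul_integral_le_sum {s : ℝ} (hs : 0 ≤ s) {K L m : ℕ} (hK : 0 < K)
    (hKm : K ≤ m) (hmL : m ≤ L) :
    (m : ℝ) ^ (-s) * ∫ x in (1 / (K : ℝ))..K, x ^ (-s) / (1 + x) ≤
      ∑ n ∈ Finset.range (K * L), ((n : ℝ) + 1) ^ (-s) / (m + (n + 1)) := by
  have hK0 : (0 : ℝ) < K := by exact_mod_cast hK
  have hK1 : (1 : ℝ) ≤ K := by exact_mod_cast hK
  have hm0 : (0 : ℝ) < m := by exact_mod_cast hK.trans_le hKm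
  have hKm' : (K : ℝ) ≤ m := by exact_mod_cast hKm
  have hmL' : (m : ℝ) ≤ L := by exact_mod_cast hmL
  have hinv : 1 / (K : ℝ) ≤ K := by
    rw [div_le_iff₀ hK0]
    nlinarith
  have hle : (m : ℝ) * (1 / K) ≤ m * K := by gcongr
  have hlow : 1 ≤ (m : ℝ) * (1 / K) := by
    rw [mul_one_div, le_div_iff₀ hK0]
    linarith
  have hup : (m : ℝ) * K ≤ 1 + (K * L : ℕ) := by
    push_cast
    nlinarith
  have anti := antitoneOn_rpow_neg_div_add hs hm0
  calc (m : ℝ) ^ (-s) * ∫ x in (1 / (K : ℝ))..K, x ^ (-s) / (1 + x)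
      = ∫ x in (1 / (K : ℝ))..K, m * ((m * x) ^ (-s) / (m + m * x)) := by
        rw [← intervalIntegral.integral_const_mul]
        refine intervalIntegral.integral_congr fun x hx => ?_
        rw [uIcc_of_le hinv] at hx
        have hx0 : 0 < x := lt_of_lt_of_le (by positivity) hx.1
        rw [mul_rpow hm0.le hx0.le]
        field_simp
    _ = ∫ x in (m : ℝ) * (1 / K)..m * K, x ^ (-s) / (m + x) := by
        rw [intervalIntegral.integral_const_mul,
          intervalIntegral.mul_integral_comp_mul_left (f := fun x : ℝ => x ^ (-s) / (m + x))]
    _ ≤ ∫ x in (1 : ℝ)..1 + (K * L : ℕ), x ^ (-s) / (m + x) := by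
        refine intervalIntegral.integral_mono_interval hlow hle hup ?_ ?_
        · filter_upwards [ae_restrict_mem measurableSet_Ioc] with x hx
          have : 0 < x := one_pos.trans hx.1
          simp only [Pi.zero_apply]
          positivity
        · refine (anti.mono fun x hx => ?_).intervalIntegrable
          rw [uIcc_of_le (by simp; positivity)] at hx
          exact one_pos.trans_le hx.1
    _ ≤ ∑ n ∈ Finset.range (K * L), (1 + (n : ℝ)) ^ (-s) / (m + (1 + n)) :=
        AntitoneOn.integral_le_sum (anti.mono fun x hx => one_pos.trans_le hx.1)
    _ = _ := by simp only [add_comm (1 : ℝ)]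

theorem sum_range_mul_one_div_succ_le (K L : ℕ) (hK : 0 < K) (hL : 0 < L) :
    ∑ n ∈ Finset.range (K * L), 1 / ((n : ℝ) + 1) ≤
      ∑ n ∈ Finset.range L, 1 / ((n : ℝ) + 1) + K := by
  have hL0 : (0 : ℝ) < L := by exact_mod_cast hL
  have hLK : L ≤ K * L := Nat.le_mul_of_pos_left L hK
  rw [← Finset.sum_range_add_sum_Ico _ hLK]
  gcongr
  calc ∑ n ∈ Finset.Ico L (K * L), 1 / ((n : ℝ) + 1)
      ≤ ∑ n ∈ Finset.Ico L (K * L), 1 / (L : ℝ) := by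
        refine Finset.sum_le_sum fun n hn => one_div_le_one_div_of_le hL0 ?_
        have : (L : ℝ) ≤ n := by exact_mod_cast (Finset.mem_Ico.1 hn).1
        linarith
    _ = ((K * L - L : ℕ) : ℝ) / L := by simp [div_eq_mul_inv]
    _ ≤ K := by
        rw [div_le_iff₀ hL0]
        exact_mod_cast Nat.sub_le _ _

/-- The truncated power sequence `n ^ (-(1 + α) / p)`, `n ≤ K * L`, forces the lower bound on the norm. -/
theorem rpow_mul_sum_sub_le {p α C I : ℝ} (hp : 1 < p) (hα : -1 < α) (hα' : α < p - 1)
    (hC : ∀ a : ℕ → ℝ, Summable (fun n : ℕ => ((n : ℝ) + 1) ^ α * |a n| ^ p) →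
      (∑' m : ℕ, ((m : ℝ) + 1) ^ α *
          |∑' n : ℕ, a n / ((m : ℝ) + (n : ℝ) + 2)| ^ p) ^ (1 / p)
        ≤ C * (∑' n : ℕ, ((n : ℝ) + 1) ^ α * |a n| ^ p) ^ (1 / p))
    {K L : ℕ} (hK : 0 < K) (hKL : K ≤ L) (hI0 : 0 ≤ I)
    (hI : I = ∫ x in (1 / (K : ℝ))..K, x ^ (-((1 + α) / p)) / (1 + x)) :
    0 ≤ C ∧ I ^ p * ∑ n ∈ Finset.Ico K L, 1 / ((n : ℝ) + 1) ≤
      C ^ p * ∑ n ∈ Finset.range (K * L), 1 / ((n : ℝ) + 1) := by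
  have hp0 : 0 < p := by linarith
  set s := (1 + α) / p with hs
  have hs0 : 0 < s := div_pos (by linarith) hp0
  have hsp : s * p = 1 + α := div_mul_cancel₀ _ hp0.ne'
  have weight (n : ℕ) : ((n : ℝ) + 1) ^ α * (((n : ℝ) + 1) ^ (-s)) ^ p = 1 / ((n : ℝ) + 1) := by
    rw [← rpow_mul (by positivity), ← rpow_add (by positivity), one_div, ← rpow_neg_one]
    congr 1
    linarith
  set a : ℕ → ℝ := fun n => if n ∈ Finset.range (K * L) then ((n : ℝ) + 1) ^ (-s) else 0 with ha
  have ha_in {n : ℕ} (hn : n ∈ Finset.range (K * L)) : a n = ((n : ℝ) + 1) ^ (-s) := if_pos hn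
  have ha_out {n : ℕ} (hn : n ∉ Finset.range (K * L)) : a n = 0 := if_neg hn
  have hnorm : HasSum (fun n : ℕ => ((n : ℝ) + 1) ^ α * |a n| ^ p)
      (∑ n ∈ Finset.range (K * L), 1 / ((n : ℝ) + 1)) := by
    have : ∑ n ∈ Finset.range (K * L), 1 / ((n : ℝ) + 1) =
        ∑ n ∈ Finset.range (K * L), ((n : ℝ) + 1) ^ α * |a n| ^ p := by
      refine Finset.sum_congr rfl fun n hn => ?_
      rw [ha_in hn, abs_of_nonneg (by positivity), weight]
    rw [this]
    refine hasSum_sum_of_ne_finset_zero fun n hn => ?_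
    rw [ha_out hn, abs_zero, zero_rpow hp0.ne', mul_zero]
  have hH : 0 < ∑ n ∈ Finset.range (K * L), 1 / ((n : ℝ) + 1) :=
    Finset.sum_pos (fun n _ => by positivity)
      (Finset.nonempty_range_iff.2 (Nat.mul_pos hK (hK.trans_le hKL)).ne')
  have hbound := hC a hnorm.summable
  rw [hnorm.tsum_eq] at hbound
  have himage : I ^ p * ∑ n ∈ Finset.Ico K L, 1 / ((n : ℝ) + 1) ≤
      ∑' m : ℕ, ((m : ℝ) + 1) ^ α * |∑' n : ℕ, a n / ((m : ℝ) + (n : ℝ) + 2)| ^ p := by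
    refine le_trans ?_ ((summable_hilbert_and_tsum_le hp hα hα' hnorm.summable).1.sum_le_tsum
      (Finset.Ico K L) fun m _ => by positivity)
    rw [Finset.mul_sum]
    refine Finset.sum_le_sum fun m hm => ?_
    obtain ⟨hm1, hm2⟩ := Finset.mem_Ico.1 hm
    have hrow : ((m : ℝ) + 1) ^ (-s) * I ≤ ∑' n : ℕ, a n / ((m : ℝ) + (n : ℝ) + 2) := by
      rw [tsum_eq_sum (s := Finset.range (K * L)) fun n hn => by rw [ha_out hn, zero_div], hI]
      have := rpow_mul_integral_le_sum hs0.le hK (hm1.trans m.le_succ) hm2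
      push_cast at this
      refine this.trans_eq (Finset.sum_congr rfl fun n hn => ?_)
      rw [ha_in hn]
      ring_nf
    calc I ^ p * (1 / ((m : ℝ) + 1))
        = ((m : ℝ) + 1) ^ α * (((m : ℝ) + 1) ^ (-s) * I) ^ p := by
          rw [← weight m, mul_rpow (by positivity) hI0]
          ring
      _ ≤ _ := by
          gcongr
          exact hrow.trans (le_abs_self _)
  have hC0 : 0 ≤ C := by
    refine nonneg_of_mul_nonneg_left (le_trans ?_ hbound) (rpow_pos_of_pos hH _)
    exact rpow_nonneg (tsum_nonneg fun m => by positivity) _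
  refine ⟨hC0, himage.trans ?_⟩
  have hT : 0 ≤ ∑' m : ℕ, ((m : ℝ) + 1) ^ α *
      |∑' n : ℕ, a n / ((m : ℝ) + (n : ℝ) + 2)| ^ p := tsum_nonneg fun m => by positivity
  have := rpow_le_rpow (by positivity) hbound hp0.le
  rwa [mul_rpow hC0 (by positivity), ← rpow_mul hT, ← rpow_mul hH.le, one_div_mul_cancel hp0.ne',
    rpow_one, rpow_one] at this

theorem stmt_11 (p α : ℝ) (hp : 1 < p) (hα : -1 < α) (hα' : α < p - 1) :
    (∀ a : ℕ → ℝ, Summable (fun n : ℕ => ((n : ℝ) + 1) ^ α * |a n| ^ p) →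
      (∑' m : ℕ, ((m : ℝ) + 1) ^ α *
          |∑' n : ℕ, a n / ((m : ℝ) + (n : ℝ) + 2)| ^ p) ^ (1/p)
        ≤ (π * (Real.sin (π * (1 + α) / p))⁻¹) *
            (∑' n : ℕ, ((n : ℝ) + 1) ^ α * |a n| ^ p) ^ (1/p))
    ∧
    (∀ C' : ℝ,
      (∀ a : ℕ → ℝ, Summable (fun n : ℕ => ((n : ℝ) + 1) ^ α * |a n| ^ p) →
        (∑' m : ℕ, ((m : ℝ) + 1) ^ α *
            |∑' n : ℕ, a n / ((m : ℝ) + (n : ℝ) + 2)| ^ p) ^ (1/p)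
          ≤ C' * (∑' n : ℕ, ((n : ℝ) + 1) ^ α * |a n| ^ p) ^ (1/p)) →
      π * (Real.sin (π * (1 + α) / p))⁻¹ ≤ C') := by
  have hp0 : 0 < p := by linarith
  have hs0 : 0 < (1 + α) / p := div_pos (by linarith) hp0
  have hs1 : (1 + α) / p < 1 := (div_lt_one hp0).2 (by linarith)
  have hB : 0 < π / sin (π * ((1 + α) / p)) := by
    refine div_pos pi_pos (sin_pos_of_pos_of_lt_pi (by positivity) ?_)
    nlinarith [pi_pos]
  rw [← div_eq_mul_inv, mul_div_assoc]
  refine ⟨fun a ha => ?_, fun C hC => ?_⟩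
  · have hS : 0 ≤ ∑' n : ℕ, ((n : ℝ) + 1) ^ α * |a n| ^ p :=
      tsum_nonneg fun n => by positivity
    have := rpow_le_rpow (tsum_nonneg fun m => by positivity)
      (summable_hilbert_and_tsum_le hp hα hα' ha).2 (one_div_nonneg.2 hp0.le)
    rwa [mul_rpow (by positivity) hS, ← rpow_mul hB.le, mul_one_div_cancel hp0.ne',
      rpow_one] at this
  · by_contra! hlt
    obtain ⟨K, hK, hI⟩ := exists_nat_lt_integral_rpow_div hs0 hs1 (max_lt hlt hB)
    set I := ∫ x in (1 / (K : ℝ))..K, x ^ (-((1 + α) / p)) / (1 + x) with hIdef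
    have hCI : C < I := (le_max_left _ _).trans_lt hI
    have hI0 : 0 ≤ I := (le_max_right _ _).trans hI.le
    have hC0 : 0 ≤ C := (rpow_mul_sum_sub_le hp hα hα' hC hK le_rfl hI0 hIdef).1
    have hpow : 0 < I ^ p - C ^ p := sub_pos.2 (rpow_lt_rpow hC0 hCI hp0)
    set M := (C ^ p * K + I ^ p * ∑ n ∈ Finset.range K, 1 / ((n : ℝ) + 1)) / (I ^ p - C ^ p)
    obtain ⟨L, hL, hKL⟩ := ((tendsto_sum_range_one_div_nat_succ_atTop.eventually_gt_atTop M).and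
      (eventually_ge_atTop K)).exists
    have h1 := (rpow_mul_sum_sub_le hp hα hα' hC hK hKL hI0 hIdef).2
    have h2 := mul_le_mul_of_nonneg_left
      (sum_range_mul_one_div_succ_le K L hK (hK.trans_le hKL)) (rpow_nonneg hC0 p)
    have h3 := Finset.sum_range_add_sum_Ico (fun n : ℕ => 1 / ((n : ℝ) + 1)) hKL
    rw [div_lt_iff₀ hpow] at hL
    rw [← eq_sub_iff_add_eq'] at h3
    rw [h3] at h1
    linarith
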